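/- Let n ≥ 2 and define f_n(v) = v·1_n^T − 1_n·v^T. If {y_1, …, y_{n−1}} is an orthogonal basis (with respect to the standard inner product on ℝ^n) of the orthogonal complement of the span of 1_n in ℝ^n, then {f_n(y_1), …, f_n(y_{n−1})} is a basis of the subspace l_n of additively consistent skew-symmetric matrices which is pairwise orthogonal with respect to the Frobenius inner product ⟨A, B⟩ = tr(A·B^T). -/

import Mathlib

open Matrix

/-- The map `f_n : ℝⁿ → M_{n,n}(ℝ)`, `f_n v = v ⬝ 1ᵀ − 1 ⬝ vᵀ`. -/
def fMap (n : ℕ) (v : Fin n → ℝ) : Matrix (Fin n) (Fin n) ℝ :=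
  Matrix.vecMulVec v 1 - Matrix.vecMulVec 1 v

/-- `l_n`: the subspace of additively consistent skew-symmetric matrices. -/
def lnSub (n : ℕ) : Submodule ℝ (Matrix (Fin n) (Fin n) ℝ) where
  carrier := {B | (∀ i j, B i j + B j i = 0) ∧ ∀ i j k, B i j + B j k + B k i = 0}
  add_mem' := by
    rintro a b ⟨ha1, ha2⟩ ⟨hb1, hb2⟩
    refine ⟨fun i j => ?_, fun i j k => ?_⟩
    · have := ha1 i j; have := hb1 i j
      simp only [Matrix.add_apply]; linarith
    · have := ha2 i j k; have := hb2 i j k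
      simp only [Matrix.add_apply]; linarith
  zero_mem' := by
    refine ⟨fun i j => ?_, fun i j k => ?_⟩ <;> simp
  smul_mem' := by
    rintro c a ⟨ha1, ha2⟩
    refine ⟨fun i j => ?_, fun i j k => ?_⟩
    · have := ha1 i j
      simp only [Matrix.smul_apply, smul_eq_mul]; linear_combination c * this
    · have := ha2 i j k
      simp only [Matrix.smul_apply, smul_eq_mul]; linear_combination c * this

/-- The orthogonal complement of `span {1ₙ}` in `ℝⁿ` (standard inner product). -/
def onesPerp (n : ℕ) : Submodule ℝ (Fin n → ℝ) where
  carrier := {v | v ⬝ᵥ (1 : Fin n → ℝ) = 0}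
  add_mem' := by
    intro a b ha hb
    simp only [Set.mem_setOf_eq, add_dotProduct] at *
    rw [ha, hb]; ring
  zero_mem' := by simp
  smul_mem' := by
    intro c a ha
    simp only [Set.mem_setOf_eq, smul_dotProduct, smul_eq_mul] at *
    rw [ha]; ring

theorem fMap_apply (n : ℕ) (v : Fin n → ℝ) (i j : Fin n) : fMap n v i j = v i - v j := by
  simp [fMap]

theorem mem_lnSub {n : ℕ} {B : Matrix (Fin n) (Fin n) ℝ} :
    B ∈ lnSub n ↔ (∀ i j, B i j + B j i = 0) ∧ ∀ i j k, B i j + B j k + B k i = 0 :=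
  Iff.rfl

theorem mem_onesPerp {n : ℕ} {v : Fin n → ℝ} : v ∈ onesPerp n ↔ ∑ i, v i = 0 := by
  change v ⬝ᵥ (1 : Fin n → ℝ) = 0 ↔ _
  rw [dotProduct_one]

/-- `fMap` as a linear map. -/
def fMapLin (n : ℕ) : (Fin n → ℝ) →ₗ[ℝ] Matrix (Fin n) (Fin n) ℝ where
  toFun := fMap n
  map_add' v w := by
    ext i j
    simp only [Matrix.add_apply, fMap_apply, Pi.add_apply]
    ring
  map_smul' c v := by
    ext i j
    simp only [Matrix.smul_apply, fMap_apply, Pi.smul_apply, smul_eq_mul, RingHom.id_apply]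
    ring

theorem fMapLin_apply (n : ℕ) (v : Fin n → ℝ) : fMapLin n v = fMap n v := rfl

theorem fMap_mem_lnSub (n : ℕ) (v : Fin n → ℝ) : fMap n v ∈ lnSub n := by
  refine mem_lnSub.2 ⟨fun i j => ?_, fun i j k => ?_⟩ <;> simp only [fMap_apply] <;> ring

theorem disjoint_onesPerp_ker_fMapLin (n : ℕ) :
    Disjoint (onesPerp n) (LinearMap.ker (fMapLin n)) := by
  rw [Submodule.disjoint_def]
  intro v hv hker
  rw [mem_onesPerp] at hv
  rw [LinearMap.mem_ker, fMapLin_apply] at hker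
  ext i
  have hconst : ∀ j, v j = v i := fun j => by
    have h := congrFun (congrFun hker j) i
    rw [fMap_apply, Matrix.zero_apply] at h
    linarith
  have hn : (n : ℝ) ≠ 0 := Nat.cast_ne_zero.2 i.pos.ne'
  simpa [Finset.sum_congr rfl fun j _ => hconst j, hn] using hv

theorem map_fMapLin_onesPerp (n : ℕ) : (onesPerp n).map (fMapLin n) = lnSub n := by
  apply le_antisymm
  · rintro _ ⟨v, -, rfl⟩
    exact fMap_mem_lnSub n v
  · intro B hB
    obtain ⟨hskew, hcons⟩ := mem_lnSub.1 hB
    refine ⟨fun i => (n : ℝ)⁻¹ * ∑ k, B i k, mem_onesPerp.2 ?_, ?_⟩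
    · have hsum : ∑ i, ∑ k, B i k = -∑ i, ∑ k, B i k := by
        refine Eq.trans ?_ (congrArg Neg.neg (Finset.sum_comm (f := fun k i => B i k)))
        simp only [← Finset.sum_neg_distrib]
        exact Finset.sum_congr rfl fun i _ => Finset.sum_congr rfl fun k _ => by
          linarith [hskew i k]
      rw [← Finset.mul_sum, self_eq_neg.1 hsum, mul_zero]
    · rw [fMapLin_apply]
      ext i j
      have hn : (n : ℝ) ≠ 0 := Nat.cast_ne_zero.2 i.pos.ne'
      have hrow : ∀ k, B i k - B j k = B i j := fun k => by
        linarith [hcons i j k, hskew i k]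
      rw [fMap_apply, ← mul_sub, ← Finset.sum_sub_distrib,
        Finset.sum_congr rfl fun k _ => hrow k]
      simp [hn]

theorem trace_fMap_mul_transpose (n : ℕ) (v w : Fin n → ℝ) :
    (fMap n v * (fMap n w)ᵀ).trace =
      2 * n * (v ⬝ᵥ w) - 2 * ((∑ i, v i) * ∑ i, w i) := by
  have hexp : ∀ i j, (v i - v j) * (w i - w j) =
      v i * w i + v j * w j - (v i * w j + w i * v j) := fun i j => by ring
  simp only [Matrix.trace, Matrix.diag_apply, Matrix.mul_apply, Matrix.transpose_apply,
    fMap_apply, hexp, Finset.sum_sub_distrib, Finset.sum_add_distrib, Finset.sum_const,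
    Finset.card_univ, Fintype.card_fin, nsmul_eq_mul, dotProduct]
  simp only [← Finset.mul_sum, ← Finset.sum_mul]
  ring

/-- if `{y 1, …, y (n-1)}` is an orthogonal basis of the orthogonal
complement of `span {1ₙ}`, then `{f_n (y 1), …, f_n (y (n-1))}` is a basis of `l_n`
which is pairwise orthogonal for the Frobenius inner product. -/
theorem frobenius_orthogonal_basis_of_ln (n : ℕ) (hn : 2 ≤ n)
    (y : Fin (n - 1) → Fin n → ℝ)
    (hy_indep : LinearIndependent ℝ y)
    (hy_span : Submodule.span ℝ (Set.range y) = onesPerp n)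
    (hy_orth : ∀ i j, i ≠ j → y i ⬝ᵥ y j = 0) :
    (∀ i, fMap n (y i) ∈ lnSub n) ∧
    LinearIndependent ℝ (fun i => fMap n (y i)) ∧
    Submodule.span ℝ (Set.range fun i => fMap n (y i)) = lnSub n ∧
    (∀ i j, i ≠ j → (fMap n (y i) * (fMap n (y j))ᵀ).trace = 0) := by
  have hmem : ∀ i, y i ∈ onesPerp n := fun i =>
    hy_span ▸ Submodule.subset_span (Set.mem_range_self i)
  have hrange : (Set.range fun i => fMap n (y i)) = fMapLin n '' Set.range y :=
    Set.range_comp (fMapLin n) y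
  refine ⟨fun i => fMap_mem_lnSub n (y i), ?_, ?_, fun i j hij => ?_⟩
  · exact hy_indep.map (f := fMapLin n) (hy_span ▸ disjoint_onesPerp_ker_fMapLin n)
  · rw [hrange, Submodule.span_image, hy_span, map_fMapLin_onesPerp]
  · rw [trace_fMap_mul_transpose, hy_orth i j hij, mem_onesPerp.1 (hmem i)]
    ring
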